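/- Let a = (a_0, a_1, …, a_c) be a determining vector and suppose K(a) = Σ_{k=1}^{ℓ} r_k·K(a^{(k)}) where each r_k is a strictly positive rational number and each a^{(k)} = (a_0^{(k)}, a_1^{(k)}, …, a_{c_k}^{(k)}) is a determining vector. Then for every k, a_0^{(k)} = a_0 and c_k = c. -/

import Mathlib

/-- The Betti diagram of the complete intersection with determining vector
`(a0, a 0, …, a (c-1))`: the entry at `(i, d)` counts the subsets `S ⊆ {1,…,c}`
with `|S| = i` and `a0 + Σ_{ℓ ∈ S} a ℓ = d`. -/
def bettiCI (c : ℕ) (a0 : ℤ) (a : Fin c → ℤ) : ℕ × ℤ → ℤ := fun p =>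
  ((Finset.univ.filter fun S : Finset (Fin c) =>
      S.card = p.1 ∧ a0 + ∑ ℓ ∈ S, a ℓ = p.2).card : ℤ)

/-- The degrees part of a determining vector: entries are at least 1 and nondecreasing. -/
def IsDetVec {c : ℕ} (a : Fin c → ℤ) : Prop := (∀ j, 1 ≤ a j) ∧ Monotone a

/-- Summing a function against a Betti diagram amounts to summing it over all subsets. -/
theorem sum_bettiCI_mul (c : ℕ) (a0 : ℤ) (a : Fin c → ℤ) (f : ℕ × ℤ → ℚ) (F : Finset (ℕ × ℤ))
    (hF : ∀ S : Finset (Fin c), (S.card, a0 + ∑ ℓ ∈ S, a ℓ) ∈ F) :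
    ∑ q ∈ F, (bettiCI c a0 a q : ℚ) * f q =
      ∑ S : Finset (Fin c), f (S.card, a0 + ∑ ℓ ∈ S, a ℓ) := by
  classical
  rw [← Finset.sum_fiberwise_of_maps_to (s := Finset.univ) (t := F)
    (g := fun S : Finset (Fin c) => (S.card, a0 + ∑ ℓ ∈ S, a ℓ)) (fun S _ => hF S)]
  refine Finset.sum_congr rfl fun q _ => ?_
  rw [Finset.sum_congr rfl (g := fun _ => f q)
    (fun S hS => by rw [(Finset.mem_filter.mp hS).2])]
  rw [Finset.sum_const, nsmul_eq_mul]
  simp only [bettiCI, Prod.ext_iff, Int.cast_natCast]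

theorem zpow_finset_sum {ι K : Type*} [Field K] {z : K} (hz : z ≠ 0) (S : Finset ι) (a : ι → ℤ) :
    z ^ (∑ i ∈ S, a i) = ∏ i ∈ S, z ^ a i := by
  classical
  induction S using Finset.induction_on with
  | empty => simp
  | insert i S hi ih => rw [Finset.sum_insert hi, Finset.prod_insert hi, zpow_add₀ hz, ih]

/-- The alternating generating function of the Betti diagram of a complete intersection. -/
theorem sum_bettiCI_mul_neg_one_pow_mul_zpow (c : ℕ) (a0 : ℤ) (a : Fin c → ℤ) {z : ℚ}
    (hz : z ≠ 0) (F : Finset (ℕ × ℤ))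
    (hF : ∀ S : Finset (Fin c), (S.card, a0 + ∑ ℓ ∈ S, a ℓ) ∈ F) :
    ∑ q ∈ F, (bettiCI c a0 a q : ℚ) * ((-1) ^ q.1 * z ^ (q.2 - a0)) = ∏ j, (1 - z ^ a j) := by
  rw [sum_bettiCI_mul c a0 a (fun q => (-1) ^ q.1 * z ^ (q.2 - a0)) F hF]
  simp only [sub_eq_add_neg, Finset.prod_one_add, Finset.powerset_univ]
  refine Finset.sum_congr rfl fun S _ => ?_
  rw [Finset.prod_neg, ← zpow_finset_sum hz]
  congr 2
  ring

theorem bettiCI_nonneg (c : ℕ) (a0 : ℤ) (a : Fin c → ℤ) (q : ℕ × ℤ) : 0 ≤ bettiCI c a0 a q :=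
  Int.natCast_nonneg _

theorem bettiCI_ne_zero_iff (c : ℕ) (a0 : ℤ) (a : Fin c → ℤ) (q : ℕ × ℤ) :
    bettiCI c a0 a q ≠ 0 ↔ ∃ S : Finset (Fin c), S.card = q.1 ∧ a0 + ∑ ℓ ∈ S, a ℓ = q.2 := by
  simp only [bettiCI, ne_eq, Nat.cast_eq_zero, Finset.card_eq_zero, ← Finset.nonempty_iff_ne_empty,
    Finset.filter_nonempty_iff, Finset.mem_univ, true_and]

theorem one_sub_zpow_le {z : ℚ} (hz : 0 ≤ z) {n : ℤ} (hn : 0 ≤ n) :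
    1 - z ^ n ≤ n * (1 - z) := by
  lift n to ℕ using hn
  have := one_add_mul_le_pow (a := z - 1) (by linarith) n
  rw [add_sub_cancel] at this
  rw [zpow_natCast, Int.cast_natCast]
  linarith

theorem one_sub_le_one_sub_zpow {z : ℚ} (hz : 0 ≤ z) (hz1 : z ≤ 1) {n : ℤ} (hn : 1 ≤ n) :
    1 - z ≤ 1 - z ^ n := by
  lift n to ℕ using by lia
  have := pow_le_of_le_one hz hz1 (n := n) (by lia)
  rw [zpow_natCast]
  linarith

theorem pow_le_prod_one_sub_zpow {c : ℕ} {a : Fin c → ℤ} (ha : ∀ j, 1 ≤ a j) {z : ℚ}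
    (hz : 0 ≤ z) (hz1 : z ≤ 1) : (1 - z) ^ c ≤ ∏ j, (1 - z ^ a j) := by
  calc (1 - z) ^ c = ∏ _j : Fin c, (1 - z) := by simp
    _ ≤ _ := Finset.prod_le_prod (fun _ _ => by linarith)
      fun j _ => one_sub_le_one_sub_zpow hz hz1 (ha j)

theorem prod_one_sub_zpow_le {c : ℕ} {a : Fin c → ℤ} (ha : ∀ j, 1 ≤ a j) {z : ℚ}
    (hz : 0 ≤ z) (hz1 : z ≤ 1) :
    ∏ j, (1 - z ^ a j) ≤ (∏ j, (a j : ℚ)) * (1 - z) ^ c := by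
  calc ∏ j, (1 - z ^ a j) ≤ ∏ j, ((a j : ℚ) * (1 - z)) :=
        Finset.prod_le_prod
          (fun j _ => by linarith [one_sub_le_one_sub_zpow hz hz1 (ha j)])
          fun j _ => one_sub_zpow_le hz (by linarith [ha j])
    _ = _ := by simp [Finset.prod_mul_distrib]

theorem le_of_mul_pow_le_mul_pow {r A : ℚ} (hr : 0 < r) (hA : 0 < A) {m n : ℕ}
    (h : ∀ ε : ℚ, 0 < ε → ε < 1 → r * ε ^ m ≤ A * ε ^ n) : n ≤ m := by
  by_contra! hmn
  have hε : 0 < r / (A + r) := by positivity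
  have hε1 : r / (A + r) < 1 := by rw [div_lt_one (by positivity)]; linarith
  have hAε : A * (r / (A + r)) < r := by
    rw [mul_div_assoc', div_lt_iff₀ (by positivity)]
    nlinarith [mul_pos hr hr]
  have h1 := h _ hε hε1
  generalize r / (A + r) = ε at *
  have h2 : ε ^ n ≤ ε ^ (m + 1) := pow_le_pow_of_le_one hε.le hε1.le hmn
  have h3 : r * ε ^ m ≤ A * ε * ε ^ m := by
    calc r * ε ^ m ≤ A * ε ^ n := h1
      _ ≤ A * ε ^ (m + 1) := by gcongr
      _ = _ := by ring
  exact absurd (le_of_mul_le_mul_right h3 (pow_pos hε m)) (not_le.mpr hAε)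

theorem stmt2 (c : ℕ) (hc : 1 ≤ c) (a0 : ℤ) (a : Fin c → ℤ) (ha : IsDetVec a)
    (l : ℕ) (r : Fin l → ℚ) (hr : ∀ k, 0 < r k)
    (c' : Fin l → ℕ) (hc' : ∀ k, 1 ≤ c' k)
    (b0 : Fin l → ℤ) (b : (k : Fin l) → Fin (c' k) → ℤ)
    (hb : ∀ k, IsDetVec (b k))
    (heq : ∀ q : ℕ × ℤ,
      (bettiCI c a0 a q : ℚ) = ∑ k, r k * (bettiCI (c' k) (b0 k) (b k) q : ℚ)) :
    ∀ k, b0 k = a0 ∧ c' k = c := by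
  classical
  have support : ∀ k q, bettiCI (c' k) (b0 k) (b k) q ≠ 0 → bettiCI c a0 a q ≠ 0 := by
    intro k q hq h0
    have hnn : ∀ j, 0 ≤ r j * (bettiCI (c' j) (b0 j) (b j) q : ℚ) := fun j =>
      mul_nonneg (hr j).le (Int.cast_nonneg (bettiCI_nonneg _ _ _ _))
    have hsum := heq q
    rw [h0, Int.cast_zero, eq_comm, Finset.sum_eq_zero_iff_of_nonneg fun j _ => hnn j] at hsum
    exact (mul_ne_zero (hr k).ne' (Int.cast_ne_zero.mpr hq)) (hsum k (Finset.mem_univ k))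
  have hb0 : ∀ k, b0 k = a0 := by
    intro k
    obtain ⟨S, hS, hS'⟩ := (bettiCI_ne_zero_iff _ _ _ _).mp <| support k (0, b0 k) <|
      (bettiCI_ne_zero_iff _ _ _ _).mpr ⟨∅, by simp⟩
    obtain rfl := Finset.card_eq_zero.mp hS
    simpa using hS'.symm
  refine fun k => ⟨hb0 k, le_antisymm ?_ ?_⟩
  · obtain ⟨S, hS, -⟩ := (bettiCI_ne_zero_iff _ _ _ _).mp <|
      support k (c' k, b0 k + ∑ ℓ, b k ℓ) <|
        (bettiCI_ne_zero_iff _ _ _ _).mpr ⟨Finset.univ, by simp⟩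
    simpa [hS] using S.card_le_univ
  · have hA : (0 : ℚ) < ∏ j, (a j : ℚ) :=
      Finset.prod_pos fun j _ => Int.cast_pos.mpr (by linarith [ha.1 j])
    refine le_of_mul_pow_le_mul_pow (hr k) hA fun ε hε hε1 => ?_
    obtain ⟨z, rfl⟩ : ∃ z, ε = 1 - z := ⟨1 - ε, by ring⟩
    have hz : 0 < z := by linarith
    have hz1 : z ≤ 1 := by linarith
    let F : Finset (ℕ × ℤ) :=
      (Finset.univ.image fun S : Finset (Fin c) => (S.card, a0 + ∑ ℓ ∈ S, a ℓ)) ∪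
        Finset.univ.biUnion fun j => Finset.univ.image
          fun S : Finset (Fin (c' j)) => (S.card, b0 j + ∑ ℓ ∈ S, b j ℓ)
    have hFa : ∀ S : Finset (Fin c), (S.card, a0 + ∑ ℓ ∈ S, a ℓ) ∈ F := fun S =>
      Finset.mem_union_left _ (Finset.mem_image_of_mem _ (Finset.mem_univ S))
    have hFb : ∀ j, ∀ S : Finset (Fin (c' j)), (S.card, b0 j + ∑ ℓ ∈ S, b j ℓ) ∈ F := fun j S =>
      Finset.mem_union_right _ <| Finset.mem_biUnion.mpr
        ⟨j, Finset.mem_univ j, Finset.mem_image_of_mem _ (Finset.mem_univ S)⟩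
    have key : ∏ j, (1 - z ^ a j) = ∑ j, r j * ∏ i, (1 - z ^ b j i) := by
      rw [← sum_bettiCI_mul_neg_one_pow_mul_zpow c a0 a hz.ne' F hFa]
      simp only [heq, Finset.sum_mul]
      rw [Finset.sum_comm]
      refine Finset.sum_congr rfl fun j _ => ?_
      rw [← sum_bettiCI_mul_neg_one_pow_mul_zpow (c' j) (b0 j) (b j) hz.ne' F (hFb j),
        Finset.mul_sum, hb0 j]
      exact Finset.sum_congr rfl fun q _ => by ring
    have lower : ∀ j, (1 - z) ^ c' j ≤ ∏ i, (1 - z ^ b j i) := fun j =>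
      pow_le_prod_one_sub_zpow (hb j).1 hz.le hz1
    calc r k * (1 - z) ^ c' k ≤ r k * ∏ i, (1 - z ^ b k i) :=
          mul_le_mul_of_nonneg_left (lower k) (hr k).le
      _ ≤ ∑ j, r j * ∏ i, (1 - z ^ b j i) :=
          Finset.single_le_sum (f := fun j => r j * ∏ i, (1 - z ^ b j i))
            (fun j _ => mul_nonneg (hr j).le ((pow_nonneg hε.le _).trans (lower j)))
            (Finset.mem_univ k)
      _ = ∏ j, (1 - z ^ a j) := key.symm
      _ ≤ _ := prod_one_sub_zpow_le ha.1 hz.le hz1
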